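/- arXiv:1601.03428 — 5 statements merged into one kernel-verified Lean document; each statement's English description precedes it below -/
import Mathlib

section
/- Let N ≥ 4 be even. Consider pairs (s, e) where s : ZMod N → ℤ is a sign sequence and e ∈ E_N, and let s' be the sequence obtained from s by reversing the sign at position 0 (s' 0 = −s 0 and s' k = s k for k ≠ 0). Then the fraction of pairs (s, e), among all 2^N · 2^(N/2) such pairs, for which there exists e' ∈ E_N with autocorr(s') + e' = autocorr(s) + e (as functions ZMod N → ℤ) is exactly (1/2) · (3/4)^(N/2 − 1). -/
/-- A sign sequence: all values are `±1`. -/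
def IsSignSeq {N : ℕ} (s : ZMod N → ℤ) : Prop := ∀ k, s k = -1 ∨ s k = 1

/-- The periodic autocorrelation of a sequence `s : ZMod N → ℤ`. -/
def autocorr {N : ℕ} [NeZero N] (s : ZMod N → ℤ) : ZMod N → ℤ :=
  fun k => ∑ l : ZMod N, s l * s (l + k)

/-- The noise set `E_N`: symmetric, vanishing at `0`, `±2` elsewhere. -/
def IsNoise {N : ℕ} (e : ZMod N → ℤ) : Prop :=
  e 0 = 0 ∧ (∀ k, e (-k) = e k) ∧ ∀ k, k ≠ 0 → (e k = -2 ∨ e k = 2)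

/-- Reverse the sign of `s` at position `0`. -/
def flip0 {N : ℕ} (s : ZMod N → ℤ) : ZMod N → ℤ :=
  fun k => if k = 0 then -s k else s k

theorem autocorr_flip0 {N : ℕ} [NeZero N] (s : ZMod N → ℤ) {k : ZMod N} (hk : k ≠ 0) :
    autocorr (flip0 s) k = autocorr s k - 2 * s 0 * (s k + s (-k)) := by
  have h : ∀ l : ZMod N, flip0 s l * flip0 s (l + k) = s l * s (l + k)
      + ((if l = 0 then -2 * s 0 * s k else 0) + if l = -k then -2 * s 0 * s (-k) else 0) := by
    intro l
    by_cases h0 : l = 0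
    · subst h0
      have : ¬ (0 = -k) := by simpa [eq_comm] using hk
      simp only [flip0, zero_add, hk, this, if_true, if_false]
      ring
    · by_cases h1 : l = -k
      · subst h1
        have : ¬ (-k = 0) := by simpa using hk
        simp only [flip0, neg_add_cancel, this, if_true, if_false]
        ring
      · have : ¬ (l + k = 0) := fun h => h1 (eq_neg_of_add_eq_zero_left h)
        simp [flip0, h0, h1, this]
  simp only [autocorr, h, Finset.sum_add_distrib, Finset.sum_ite_eq', Finset.mem_univ, if_true]
  ring

theorem autocorr_flip0_zero {N : ℕ} [NeZero N] (s : ZMod N → ℤ) :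
    autocorr (flip0 s) 0 = autocorr s 0 := by
  simp only [autocorr, add_zero]
  refine Finset.sum_congr rfl fun l _ => ?_
  unfold flip0
  split_ifs <;> ring

theorem exists_noise_autocorr_flip0_iff {N : ℕ} [NeZero N] {s e : ZMod N → ℤ}
    (hs : IsSignSeq s) (he : IsNoise e) :
    (∃ e' : ZMod N → ℤ, IsNoise e' ∧ autocorr (flip0 s) + e' = autocorr s + e) ↔
      ∀ k, k ≠ 0 → (s k = s (-k) → e k = -2 * s 0 * s k) := by
  obtain ⟨he0, hesymm, hval⟩ := he
  constructor
  · rintro ⟨e', ⟨-, -, hval'⟩, h⟩ k hk hsk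
    have h1 := congrFun h k
    simp only [Pi.add_apply, autocorr_flip0 s hk, ← hsk] at h1
    rcases hs 0 with h0 | h0 <;> rcases hs k with h2 | h2 <;> rw [h0, h2] at h1 ⊢ <;>
      rcases hval k hk with h3 | h3 <;> rcases hval' k hk with h4 | h4 <;> omega
  · intro h
    refine ⟨fun k => if k = 0 then 0 else e k + 2 * s 0 * (s k + s (-k)), ⟨by simp, ?_, ?_⟩, ?_⟩
    · intro k
      simp [hesymm, add_comm (s k)]
    · intro k hk
      simp only [hk, if_false]
      have h1 := h k hk
      rcases hs 0 with h0 | h0 <;> rcases hs k with h2 | h2 <;> rcases hs (-k) with h5 | h5 <;>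
        rw [h0, h2, h5] at h1 ⊢ <;> rcases hval k hk with h3 | h3 <;> omega
    · funext k
      by_cases hk : k = 0
      · subst hk
        simp [autocorr_flip0_zero, he0]
      · simp only [Pi.add_apply, autocorr_flip0 s hk, hk, if_false]
        ring

/-- Every residue modulo `2 * m + 2` is `0`, the midpoint `m + 1`, or `±(i + 1)` with `i < m`. -/
theorem ZMod.eq_zero_or_mid_or_pair {m : ℕ} (k : ZMod (2 * m + 2)) :
    k = 0 ∨ k = ((m + 1 : ℕ) : ZMod (2 * m + 2)) ∨
      ∃ i : Fin m, k = ((i + 1 : ℕ) : ZMod (2 * m + 2)) ∨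
        k = -((i + 1 : ℕ) : ZMod (2 * m + 2)) := by
  have hlt := ZMod.val_lt k
  have hk : ((k.val : ℕ) : ZMod (2 * m + 2)) = k := ZMod.natCast_zmod_val k
  rcases Nat.lt_trichotomy k.val (m + 1) with h | h | h
  · by_cases h0 : k.val = 0
    · exact Or.inl (by simpa using h0)
    · refine Or.inr (Or.inr ⟨⟨k.val - 1, by omega⟩, Or.inl ?_⟩)
      rw [show k.val - 1 + 1 = k.val by omega, hk]
  · exact Or.inr (Or.inl (by rw [← h, hk]))
  · refine Or.inr (Or.inr ⟨⟨2 * m + 2 - k.val - 1, by omega⟩, Or.inr ?_⟩)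
    rw [eq_neg_iff_add_eq_zero]
    nth_rewrite 1 [← hk]
    rw [← Nat.cast_add, show k.val + (2 * m + 2 - k.val - 1 + 1) = 2 * m + 2 by omega,
      ZMod.natCast_self]

theorem ZMod.neg_mid {m : ℕ} :
    -((m + 1 : ℕ) : ZMod (2 * m + 2)) = ((m + 1 : ℕ) : ZMod (2 * m + 2)) := by
  rw [neg_eq_iff_add_eq_zero, ← Nat.cast_add, show m + 1 + (m + 1) = 2 * m + 2 by ring,
    ZMod.natCast_self]

/-- The function on `ZMod (2 * m + 2)` with value `a` at `0`, `b` at the midpoint, and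
`c i`, `d i` at `i + 1`, `-(i + 1)`. -/
def glue {m : ℕ} (a b : ℤ) (c d : Fin m → ℤ) (k : ZMod (2 * m + 2)) : ℤ :=
  if k.val = 0 then a
  else if h : k.val - 1 < m then c ⟨k.val - 1, h⟩
  else if h : 2 * m + 2 - k.val - 1 < m then d ⟨2 * m + 2 - k.val - 1, h⟩
  else b

section glue

variable {m : ℕ} (a b : ℤ) (c d : Fin m → ℤ)

theorem glue_zero : glue a b c d 0 = a := by simp [glue]

theorem glue_mid : glue a b c d ((m + 1 : ℕ) : ZMod (2 * m + 2)) = b := by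
  have h : ((m + 1 : ℕ) : ZMod (2 * m + 2)).val = m + 1 := ZMod.val_natCast_of_lt (by omega)
  unfold glue
  rw [h, if_neg (by omega), dif_neg (by omega), dif_neg (by omega)]

theorem ZMod.val_fin_succ (i : Fin m) : ((i + 1 : ℕ) : ZMod (2 * m + 2)).val = i + 1 :=
  ZMod.val_natCast_of_lt (by omega)

theorem ZMod.fin_succ_ne_zero (i : Fin m) : ((i + 1 : ℕ) : ZMod (2 * m + 2)) ≠ 0 := by
  intro h
  have := ZMod.val_fin_succ i
  rw [h, ZMod.val_zero] at this
  omega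

theorem ZMod.mid_ne_zero : ((m + 1 : ℕ) : ZMod (2 * m + 2)) ≠ 0 := by
  intro h
  have h1 : ((m + 1 : ℕ) : ZMod (2 * m + 2)).val = m + 1 := ZMod.val_natCast_of_lt (by omega)
  rw [h, ZMod.val_zero] at h1
  omega

theorem glue_succ (i : Fin m) : glue a b c d ((i + 1 : ℕ) : ZMod (2 * m + 2)) = c i := by
  have hi := i.2
  unfold glue
  rw [ZMod.val_fin_succ, if_neg (by omega), dif_pos (by omega)]
  congr 1

theorem glue_neg_succ (i : Fin m) :
    glue a b c d (-((i + 1 : ℕ) : ZMod (2 * m + 2))) = d i := by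
  have h : (-((i + 1 : ℕ) : ZMod (2 * m + 2))).val = 2 * m + 2 - (i + 1) := by
    rw [ZMod.neg_val, if_neg (ZMod.fin_succ_ne_zero i), ZMod.val_fin_succ]
  have hi := i.2
  unfold glue
  rw [h, if_neg (by omega), dif_neg (by omega), dif_pos (by omega)]
  congr 1
  ext
  simp only
  omega

end glue

/-- Counting sign/noise pairs subject to a local constraint on `(s 0, s k, s (-k), e k)`. -/
theorem ncard_pairs (m : ℕ) (Q : ℤ → ℤ → ℤ → ℤ → Prop)
    [∀ a x y z, Decidable (Q a x y z)] (hQ : ∀ a x y z, Q a x y z → Q a y x z) :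
    {p : (ZMod (2 * m + 2) → ℤ) × (ZMod (2 * m + 2) → ℤ) | IsSignSeq p.1 ∧ IsNoise p.2 ∧
      ∀ k, k ≠ 0 → Q (p.1 0) (p.1 k) (p.1 (-k)) (p.2 k)}.ncard =
    ∑ a ∈ ({-1, 1} : Finset ℤ),
      ((({-1, 1} : Finset ℤ) ×ˢ ({-2, 2} : Finset ℤ)).filter fun b => Q a b.1 b.1 b.2).card *
      ((({-1, 1} : Finset ℤ) ×ˢ ({-1, 1} : Finset ℤ) ×ˢ ({-2, 2} : Finset ℤ)).filter
        fun c => Q a c.1 c.2.1 c.2.2).card ^ m := by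
  let T : Finset (Σ _ : ℤ, (ℤ × ℤ) × (Fin m → ℤ × ℤ × ℤ)) :=
    ({-1, 1} : Finset ℤ).sigma fun a =>
      ((({-1, 1} : Finset ℤ) ×ˢ ({-2, 2} : Finset ℤ)).filter fun b => Q a b.1 b.1 b.2) ×ˢ
      Fintype.piFinset fun _ : Fin m =>
        ((({-1, 1} : Finset ℤ) ×ˢ ({-1, 1} : Finset ℤ) ×ˢ ({-2, 2} : Finset ℤ)).filter
          fun c => Q a c.1 c.2.1 c.2.2)
  have hT : T.card = ∑ a ∈ ({-1, 1} : Finset ℤ),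
      ((({-1, 1} : Finset ℤ) ×ˢ ({-2, 2} : Finset ℤ)).filter fun b => Q a b.1 b.1 b.2).card *
      ((({-1, 1} : Finset ℤ) ×ˢ ({-1, 1} : Finset ℤ) ×ˢ ({-2, 2} : Finset ℤ)).filter
        fun c => Q a c.1 c.2.1 c.2.2).card ^ m := by
    simp only [T, Finset.card_sigma, Finset.card_product, Fintype.card_piFinset,
      Finset.prod_const, Finset.card_univ, Fintype.card_fin]
  rw [← hT, ← Set.ncard_coe_finset]
  let F : (ZMod (2 * m + 2) → ℤ) × (ZMod (2 * m + 2) → ℤ) →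
      (Σ _ : ℤ, (ℤ × ℤ) × (Fin m → ℤ × ℤ × ℤ)) := fun p =>
    ⟨p.1 0, (p.1 ((m + 1 : ℕ) : ZMod (2 * m + 2)), p.2 ((m + 1 : ℕ) : ZMod (2 * m + 2))),
      fun i => (p.1 ((i + 1 : ℕ) : ZMod (2 * m + 2)), p.1 (-((i + 1 : ℕ) : ZMod (2 * m + 2))),
        p.2 ((i + 1 : ℕ) : ZMod (2 * m + 2)))⟩
  let G : (Σ _ : ℤ, (ℤ × ℤ) × (Fin m → ℤ × ℤ × ℤ)) →
      (ZMod (2 * m + 2) → ℤ) × (ZMod (2 * m + 2) → ℤ) := fun t =>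
    (glue t.1 t.2.1.1 (fun i => (t.2.2 i).1) (fun i => (t.2.2 i).2.1),
      glue 0 t.2.1.2 (fun i => (t.2.2 i).2.2) (fun i => (t.2.2 i).2.2))
  have hinv : Set.InvOn G F {p : (ZMod (2 * m + 2) → ℤ) × (ZMod (2 * m + 2) → ℤ) |
      IsSignSeq p.1 ∧ IsNoise p.2 ∧ ∀ k, k ≠ 0 → Q (p.1 0) (p.1 k) (p.1 (-k)) (p.2 k)}
      (T : Set _) := by
    constructor
    · rintro ⟨s, e⟩ ⟨-, ⟨he0, hesymm, -⟩, -⟩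
      simp only at he0 hesymm
      refine Prod.ext (funext fun k => ?_) (funext fun k => ?_) <;>
        obtain rfl | rfl | ⟨i, rfl | rfl⟩ := ZMod.eq_zero_or_mid_or_pair k <;>
        simp only [F, G, glue_zero, glue_mid, glue_succ, glue_neg_succ, he0, hesymm]
    · rintro ⟨a, b, c⟩ -
      simp only [F, G, glue_zero, glue_mid, glue_succ, glue_neg_succ]
  refine Set.BijOn.ncard_eq (f := F) (hinv.bijOn ?_ ?_)
  · rintro ⟨s, e⟩ ⟨hs, ⟨-, -, hval⟩, hq⟩
    simp only at hs hval hq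
    have hmid := hq _ (ZMod.mid_ne_zero (m := m))
    rw [ZMod.neg_mid] at hmid
    simp only [T, F, Finset.mem_coe, Finset.mem_sigma, Finset.mem_product, Finset.mem_filter,
      Fintype.mem_piFinset, Finset.mem_insert, Finset.mem_singleton]
    exact ⟨hs _, ⟨⟨hs _, hval _ ZMod.mid_ne_zero⟩, hmid⟩, fun i =>
      ⟨⟨hs _, hs _, hval _ (ZMod.fin_succ_ne_zero i)⟩, hq _ (ZMod.fin_succ_ne_zero i)⟩⟩
  · rintro ⟨a, b, c⟩ h
    simp only [T, Finset.mem_coe, Finset.mem_sigma, Finset.mem_product, Finset.mem_filter,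
      Fintype.mem_piFinset, Finset.mem_insert, Finset.mem_singleton] at h
    obtain ⟨ha, ⟨⟨hb1, hb2⟩, hbQ⟩, hc⟩ := h
    refine ⟨fun k => ?_, ⟨by simp only [G, glue_zero], fun k => ?_, fun k hk => ?_⟩, fun k hk => ?_⟩ <;>
      obtain rfl | rfl | ⟨i, rfl | rfl⟩ := ZMod.eq_zero_or_mid_or_pair k <;>
      simp only [G, glue_zero, glue_mid, glue_succ, glue_neg_succ, ZMod.neg_mid, neg_neg,
        neg_zero]
    · exact ha
    · exact hb1
    · exact (hc i).1.1
    · exact (hc i).1.2.1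
    · exact absurd rfl hk
    · exact hb2
    · exact (hc i).1.2.2
    · exact (hc i).1.2.2
    · exact absurd rfl hk
    · exact hbQ
    · exact (hc i).2
    · exact hQ _ _ _ _ (hc i).2

theorem stmt_1 (N : ℕ) [NeZero N] (hN4 : 4 ≤ N) (heven : Even N) :
    {p : (ZMod N → ℤ) × (ZMod N → ℤ) | IsSignSeq p.1 ∧ IsNoise p.2}.ncard
      = 2 ^ N * 2 ^ (N / 2) ∧
    (({p : (ZMod N → ℤ) × (ZMod N → ℤ) | IsSignSeq p.1 ∧ IsNoise p.2 ∧
        ∃ e' : ZMod N → ℤ, IsNoise e' ∧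
          autocorr (flip0 p.1) + e' = autocorr p.1 + p.2}.ncard : ℚ)
      / ({p : (ZMod N → ℤ) × (ZMod N → ℤ) | IsSignSeq p.1 ∧ IsNoise p.2}.ncard : ℚ)
      = (1 / 2) * (3 / 4) ^ (N / 2 - 1)) := by
  obtain ⟨m, rfl⟩ : ∃ m, N = 2 * m + 2 := by
    obtain ⟨r, rfl⟩ := heven
    exact ⟨r - 1, by omega⟩
  have htotal : {p : (ZMod (2 * m + 2) → ℤ) × (ZMod (2 * m + 2) → ℤ) |
      IsSignSeq p.1 ∧ IsNoise p.2}.ncard = 8 * 8 ^ m := by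
    have h := ncard_pairs m (fun _ _ _ _ => True) (fun _ _ _ _ h => h)
    simp only [implies_true, and_true] at h
    rw [h]
    simp
    ring
  have hgood : {p : (ZMod (2 * m + 2) → ℤ) × (ZMod (2 * m + 2) → ℤ) |
      IsSignSeq p.1 ∧ IsNoise p.2 ∧ ∃ e' : ZMod (2 * m + 2) → ℤ, IsNoise e' ∧
        autocorr (flip0 p.1) + e' = autocorr p.1 + p.2}.ncard = 4 * 6 ^ m := by
    have h := ncard_pairs m (fun a x y z => x = y → z = -2 * a * x)
      (fun a x y z h hxy => by rw [h hxy.symm, hxy])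
    have hset : {p : (ZMod (2 * m + 2) → ℤ) × (ZMod (2 * m + 2) → ℤ) |
        IsSignSeq p.1 ∧ IsNoise p.2 ∧ ∃ e' : ZMod (2 * m + 2) → ℤ, IsNoise e' ∧
          autocorr (flip0 p.1) + e' = autocorr p.1 + p.2} =
        {p | IsSignSeq p.1 ∧ IsNoise p.2 ∧
          ∀ k, k ≠ 0 → (p.1 k = p.1 (-k) → p.2 k = -2 * p.1 0 * p.1 k)} := by
      ext p
      exact and_congr_right fun hs => and_congr_right fun he =>
        exists_noise_autocorr_flip0_iff hs he
    rw [hset, h, Finset.sum_pair (by decide)]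
    have h1 : ∀ a ∈ ({-1, 1} : Finset ℤ),
        ((({-1, 1} : Finset ℤ) ×ˢ ({-2, 2} : Finset ℤ)).filter
          fun b => b.1 = b.1 → b.2 = -2 * a * b.1).card = 2 := by decide
    have h2 : ∀ a ∈ ({-1, 1} : Finset ℤ),
        ((({-1, 1} : Finset ℤ) ×ˢ ({-1, 1} : Finset ℤ) ×ˢ ({-2, 2} : Finset ℤ)).filter
          fun c => c.1 = c.2.1 → c.2.2 = -2 * a * c.1).card = 6 := by decide
    rw [h1 _ (by simp), h1 _ (by simp), h2 _ (by simp), h2 _ (by simp)]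
    ring
  have hdiv : (2 * m + 2) / 2 = m + 1 := by omega
  rw [hgood, htotal, hdiv, Nat.add_sub_cancel]
  constructor
  · rw [← pow_add, show 2 * m + 2 + (m + 1) = 3 * (m + 1) by ring, pow_mul, pow_succ']
    norm_num
  · push_cast
    rw [mul_div_mul_comm, ← div_pow]
    norm_num
end

section
/- Let N ≥ 1 and let s : ZMod N → ℤ be a sign sequence with autocorrelation a = autocorr(s). Then for every k ∈ ZMod N, a k ≡ N (mod 4). -/
theorem autocorr_sub_eq_sum {N : ℕ} [NeZero N] (s : ZMod N → ℤ) (k : ZMod N) :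
    autocorr s k - N = ∑ l : ZMod N, ((s l - 1) * (s (l + k) - 1) + 2 * (s l - 1)) := by
  have hshift : ∑ l : ZMod N, s (l + k) = ∑ l : ZMod N, s l :=
    Equiv.sum_comp (Equiv.addRight k) s
  have hterm : ∀ l : ZMod N, (s l - 1) * (s (l + k) - 1) + 2 * (s l - 1) =
      s l * s (l + k) + s l - s (l + k) - 1 := fun l => by ring
  simp [autocorr, hterm, Finset.sum_add_distrib, Finset.sum_sub_distrib, hshift, ZMod.card]

theorem stmt_3 (N : ℕ) [NeZero N] (hN : 1 ≤ N)
    (s : ZMod N → ℤ) (hs : IsSignSeq s) :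
    ∀ k : ZMod N, autocorr s k ≡ (N : ℤ) [ZMOD 4] := by
  intro k
  refine (Int.modEq_of_dvd ?_).symm
  rw [autocorr_sub_eq_sum]
  refine Finset.dvd_sum fun l _ => ?_
  rcases hs l with h | h <;> rcases hs (l + k) with h' | h' <;> norm_num [h, h']
end

section
/- Let p be an odd prime and let s : ZMod p → ℤ be the Legendre sequence: s 0 = 1 and s k = χ(k) for k ≠ 0, where χ is the Legendre symbol mod p. Then for every k ∈ ZMod p with k ≠ 0, the autocorrelation satisfies autocorr(s) k = −1 + χ(k) + χ(−k). -/
/-- The Legendre symbol as a function `ZMod p → ℤ`. -/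
def legChar (p : ℕ) [Fact p.Prime] (k : ZMod p) : ℤ := legendreSym p k.val

/-- The Legendre sequence: `1` at `0`, the Legendre symbol elsewhere. -/
def legSeq (p : ℕ) [Fact p.Prime] (k : ZMod p) : ℤ :=
  if k = 0 then 1 else legChar p k

open Finset in
/-- For a nontrivial quadratic character `χ` of a finite field and `k ≠ 0`, the correlation sum
`∑ x, χ x * χ (x + k)` equals `-1`. -/
theorem MulChar.IsQuadratic.sum_mul_apply_add {F : Type*} [Field F] [Fintype F] [DecidableEq F]
    {χ : MulChar F ℤ} (hq : χ.IsQuadratic) (hχ : χ ≠ 1) {k : F} (hk : k ≠ 0) :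
    ∑ x, χ x * χ (x + k) = -1 := by
  have hsq (a : F) (ha : a ≠ 0) : χ a * χ a = 1 := by
    rw [← MulChar.mul_apply, ← sq, hq.sq_eq_one, MulChar.one_apply ha.isUnit]
  have hneg : (-1 : F) ≠ 0 := neg_ne_zero.mpr one_ne_zero
  have hJ : ∑ x, χ x * χ (1 - x) = -χ (-1) := by
    have h := jacobiSum_nontrivial_inv hχ
    rwa [hq.inv, jacobiSum] at h
  calc ∑ x, χ x * χ (x + k)
      = ∑ x, χ (-k * x) * χ (-k * x + k) :=
        (Equiv.sum_comp (Equiv.mulLeft₀ (-k) (neg_ne_zero.mpr hk)) fun x ↦ χ x * χ (x + k)).symm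
    _ = ∑ x, χ (-1) * (χ x * χ (1 - x)) := by
        refine sum_congr rfl fun x _ ↦ ?_
        rw [show -k * x = -1 * k * x by ring, show -1 * k * x + k = k * (1 - x) by ring]
        simp only [map_mul]
        linear_combination χ (-1) * χ x * χ (1 - x) * hsq k hk
    _ = -1 := by
        rw [← mul_sum, hJ]
        linear_combination -hsq (-1) hneg

theorem legChar_eq_quadraticChar (p : ℕ) [Fact p.Prime] (k : ZMod p) :
    legChar p k = quadraticChar (ZMod p) k := by
  simp [legChar, legendreSym]

theorem legSeq_eq_quadraticChar_add (p : ℕ) [Fact p.Prime] (k : ZMod p) :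
    legSeq p k = quadraticChar (ZMod p) k + if k = 0 then 1 else 0 := by
  by_cases hk : k = 0 <;> simp [legSeq, hk, legChar_eq_quadraticChar]

theorem stmt_11 (p : ℕ) [Fact p.Prime] (hodd : Odd p) :
    ∀ k : ZMod p, k ≠ 0 →
      autocorr (legSeq p) k = -1 + legChar p k + legChar p (-k) := by
  intro k hk
  have hp : ringChar (ZMod p) ≠ 2 := by
    rw [ZMod.ringChar_zmod_n]
    rintro rfl
    exact absurd hodd (by decide)
  have hsum := (quadraticChar_isQuadratic (ZMod p)).sum_mul_apply_add (quadraticChar_ne_one hp) hk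
  simp only [autocorr, legSeq_eq_quadraticChar_add, legChar_eq_quadraticChar, add_mul, mul_add,
    Finset.sum_add_distrib, hsum, add_eq_zero_iff_eq_neg]
  simp [hk]
end

section
/- Let p be a prime with p ≡ 3 (mod 4) and let s : ZMod p → ℤ be the Legendre sequence. Then s is a perfect Hadamard sequence: Σ_{k} s k = 1 and autocorr(s) k = −1 for every k ≠ 0. -/
theorem legSeq_eq_ite_add_quadraticChar (p : ℕ) [Fact p.Prime] (k : ZMod p) :
    legSeq p k = (if k = 0 then 1 else 0) + quadraticChar (ZMod p) k := by
  by_cases hk : k = 0 <;> simp [legSeq, hk, legChar_eq_quadraticChar]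

/-- The autocorrelation of the quadratic character of a finite field of odd characteristic is `-1`
away from `0`. -/
theorem sum_quadraticChar_mul_quadraticChar_add {F : Type*} [Field F] [Fintype F] [DecidableEq F]
    (hF : ringChar F ≠ 2) {k : F} (hk : k ≠ 0) :
    ∑ l : F, quadraticChar F l * quadraticChar F (l + k) = -1 := by
  have hJ := jacobiSum_nontrivial_inv (quadraticChar_ne_one hF)
  rw [(quadraticChar_isQuadratic F).inv, jacobiSum] at hJ
  rw [← (mulLeft_bijective₀ (-k) (neg_ne_zero.mpr hk)).sum_comp]
  have h (x : F) : quadraticChar F (-k * x) * quadraticChar F (-k * x + k) =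
      quadraticChar F (-1) * (quadraticChar F x * quadraticChar F (1 - x)) := by
    rw [show -k * x + k = k * (1 - x) by ring, show -k * x = -1 * (k * x) by ring]
    simp only [map_mul]
    linear_combination quadraticChar F (-1) * quadraticChar F x * quadraticChar F (1 - x) *
      quadraticChar_sq_one hk
  simp only [h]
  rw [← Finset.mul_sum, hJ]
  linear_combination -quadraticChar_sq_one (neg_ne_zero.mpr (one_ne_zero (α := F)))

theorem stmt_12 (p : ℕ) [Fact p.Prime] (h3 : p % 4 = 3) :
    (∀ k : ZMod p, legSeq p k = -1 ∨ legSeq p k = 1) ∧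
    (∑ k : ZMod p, legSeq p k) = 1 ∧
    (∀ k : ZMod p, k ≠ 0 → autocorr (legSeq p) k = -1) := by
  have hF : ringChar (ZMod p) ≠ 2 := by
    rw [ZMod.ringChar_zmod_n]
    omega
  have hneg : quadraticChar (ZMod p) (-1) = -1 := by
    rw [quadraticChar_neg_one hF, ZMod.card, ZMod.χ₄_nat_three_mod_four h3]
  refine ⟨fun k => ?_, ?_, fun k hk => ?_⟩
  · by_cases hk : k = 0
    · simp [legSeq, hk]
    · simpa [legSeq, hk, legChar_eq_quadraticChar] using (quadraticChar_dichotomy hk).symm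
  · simp [-quadraticChar_apply, legSeq_eq_ite_add_quadraticChar, Finset.sum_add_distrib,
      quadraticChar_sum_zero hF]
  · have hχ : quadraticChar (ZMod p) (-k) = -quadraticChar (ZMod p) k := by
      rw [← neg_one_mul k, map_mul, hneg, neg_one_mul]
    simp [-quadraticChar_apply, autocorr, legSeq_eq_ite_add_quadraticChar, add_mul, mul_add,
      Finset.sum_add_distrib, add_eq_zero_iff_eq_neg, hk, hχ,
      sum_quadraticChar_mul_quadraticChar_add hF hk]
end

section
/- Let p be a prime with p ≡ 1 (mod 4) and let s : ZMod p → ℤ be the Legendre sequence, with unnormalized discrete Fourier transform S q = Σ_{k : ZMod p} (s k : ℂ) * exp(2πi·k·q/p). Then Π_{q ≠ 0} ‖S q‖² = (p − 1)^(p − 1); equivalently, the hardness index of s (the geometric mean of the normalized squared magnitudes ‖S q‖²/p over q ≠ 0) equals 1 − 1/p. -/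
/-- The unnormalized discrete Fourier transform of `x : ZMod N → ℂ`. -/
noncomputable def dft {N : ℕ} [NeZero N] (x : ZMod N → ℂ) (q : ZMod N) : ℂ :=
  ∑ k : ZMod N, x k * Complex.exp (2 * Real.pi * Complex.I * k.val * q.val / N)

/-- The discrete Fourier transform written with the standard additive character of `ZMod N`. -/
theorem dft_eq_sum_stdAddChar {N : ℕ} [NeZero N] (x : ZMod N → ℂ) (q : ZMod N) :
    dft x q = ∑ k : ZMod N, x k * ZMod.stdAddChar (q * k) := by
  refine Finset.sum_congr rfl fun k _ => ?_
  have h : ((((q.val * k.val : ℕ) : ℤ) : ZMod N)) = q * k := by simp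
  rw [← h, ZMod.stdAddChar_coe]
  push_cast
  congr 2
  ring

/-- The complex-valued quadratic character of `ZMod p`. -/
noncomputable def complexQuadraticChar (p : ℕ) [Fact p.Prime] : MulChar (ZMod p) ℂ :=
  (quadraticChar (ZMod p)).ringHomComp (Int.castRingHom ℂ)

theorem complexQuadraticChar_isQuadratic (p : ℕ) [Fact p.Prime] :
    (complexQuadraticChar p).IsQuadratic :=
  (quadraticChar_isQuadratic (ZMod p)).comp _

theorem legSeq_cast (p : ℕ) [Fact p.Prime] (k : ZMod p) :
    ((legSeq p k : ℤ) : ℂ) = (if k = 0 then 1 else 0) + complexQuadraticChar p k := by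
  by_cases hk : k = 0
  · simp [legSeq, hk, MulChar.map_zero]
  · simp [legSeq, hk, legChar, legendreSym, complexQuadraticChar]

/-- Away from zero, the Fourier transform of the Legendre sequence is one plus a Gauss sum. -/
theorem dft_legSeq (p : ℕ) [Fact p.Prime] {q : ZMod p} (hq : q ≠ 0) :
    dft (fun k => ((legSeq p k : ℤ) : ℂ)) q =
      1 + complexQuadraticChar p q * gaussSum (complexQuadraticChar p) ZMod.stdAddChar := by
  rw [dft_eq_sum_stdAddChar]
  have hG := gaussSum_mulShift_eq (complexQuadraticChar p) ZMod.stdAddChar (Units.mk0 q hq)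
  rw [(complexQuadraticChar_isQuadratic p).inv, Units.val_mk0] at hG
  rw [← hG]
  simp [legSeq_cast, add_mul, Finset.sum_add_distrib, gaussSum, AddChar.mulShift_apply]

theorem gaussSum_complexQuadraticChar_sq (p : ℕ) [Fact p.Prime] (h1 : p % 4 = 1) :
    gaussSum (complexQuadraticChar p) ZMod.stdAddChar ^ 2 = p := by
  have hp2 : ringChar (ZMod p) ≠ 2 := by rw [ZMod.ringChar_zmod_n]; omega
  have hne : complexQuadraticChar p ≠ 1 :=
    (MulChar.ringHomComp_ne_one_iff Int.cast_injective).mpr (quadraticChar_ne_one hp2)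
  have hneg : complexQuadraticChar p (-1) = 1 := by
    have hsq : IsSquare (-1 : ZMod p) := ZMod.exists_sq_eq_neg_one_iff.mpr (by omega)
    have : quadraticChar (ZMod p) (-1) = 1 :=
      (quadraticChar_one_iff_isSquare (neg_ne_zero.mpr one_ne_zero)).mpr hsq
    simp [complexQuadraticChar, this]
  rw [gaussSum_sq hne (complexQuadraticChar_isQuadratic p) (ZMod.isPrimitive_stdAddChar p), hneg,
    one_mul, ZMod.card]

theorem card_univ_sdiff_zero (p : ℕ) [Fact p.Prime] :
    (Finset.univ \ {(0 : ZMod p)}).card = p - 1 := by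
  rw [Finset.card_sdiff_of_subset (by simp)]
  simp [ZMod.card]

/-- Since `q ↦ n * q` for a nonresidue `n` swaps the factors `1 + χ q * G` and `1 - χ q * G`, the
square of the product is `∏ q ≠ 0, ‖1 - G ^ 2‖ ^ 2`. -/
theorem prod_norm_sq_dft_legSeq (p : ℕ) [Fact p.Prime] (h1 : p % 4 = 1) :
    ∏ q ∈ Finset.univ \ {(0 : ZMod p)}, ‖dft (fun k => ((legSeq p k : ℤ) : ℂ)) q‖ ^ 2 =
      ((p : ℝ) - 1) ^ (p - 1) := by
  have hp1 : (1 : ℝ) ≤ p := by exact_mod_cast (Fact.out : p.Prime).one_le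
  have hp2 : ringChar (ZMod p) ≠ 2 := by rw [ZMod.ringChar_zmod_n]; omega
  obtain ⟨n, hn⟩ := quadraticChar_exists_neg_one hp2
  have hn0 : n ≠ 0 := by rintro rfl; simp at hn
  have hχn : complexQuadraticChar p n = -1 := by simp [complexQuadraticChar, hn]
  set χ := complexQuadraticChar p with hχ
  set G := gaussSum χ ZMod.stdAddChar with hG
  have hGsq : G ^ 2 = p := gaussSum_complexQuadraticChar_sq p h1
  have hprod : ∏ q ∈ Finset.univ \ {(0 : ZMod p)}, ‖dft (fun k => ((legSeq p k : ℤ) : ℂ)) q‖ ^ 2 =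
      ∏ q ∈ Finset.univ \ {(0 : ZMod p)}, ‖1 + χ q * G‖ ^ 2 :=
    Finset.prod_congr rfl fun q hq => by rw [dft_legSeq p (by simpa using hq)]
  have hflip : ∏ q ∈ Finset.univ \ {(0 : ZMod p)}, ‖1 + χ q * G‖ ^ 2 =
      ∏ q ∈ Finset.univ \ {(0 : ZMod p)}, ‖1 - χ q * G‖ ^ 2 := by
    refine (Finset.prod_equiv (Equiv.mulLeft₀ n hn0) (by simp [hn0]) fun q _ => ?_).symm
    simp [hχn, sub_eq_add_neg]
  have hfactor : ∀ q ∈ Finset.univ \ {(0 : ZMod p)},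
      ‖1 + χ q * G‖ ^ 2 * ‖1 - χ q * G‖ ^ 2 = ((p : ℝ) - 1) ^ 2 := by
    intro q hq
    have hq0 : q ≠ 0 := by simpa using hq
    have hχq : χ q ^ 2 = 1 := by
      have := quadraticChar_sq_one hq0
      simp only [hχ, complexQuadraticChar, MulChar.ringHomComp_apply, eq_intCast]
      exact_mod_cast this
    have hmul : (1 + χ q * G) * (1 - χ q * G) = -(((p : ℝ) - 1 : ℝ) : ℂ) := by
      push_cast
      linear_combination -hχq * G ^ 2 - hGsq
    rw [← mul_pow, ← norm_mul, hmul, norm_neg, Complex.norm_real, Real.norm_eq_abs, sq_abs]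
  rw [hprod]
  refine (sq_eq_sq₀ (Finset.prod_nonneg fun _ _ => by positivity)
    (pow_nonneg (by linarith) _)).mp ?_
  rw [sq]
  nth_rewrite 2 [hflip]
  rw [← Finset.prod_mul_distrib, Finset.prod_congr rfl hfactor, Finset.prod_const, card_univ_sdiff_zero,
    pow_right_comm]

theorem stmt_19 (p : ℕ) [Fact p.Prime] (h1 : p % 4 = 1) :
    (∏ q ∈ Finset.univ \ {(0 : ZMod p)},
        ‖dft (fun k => ((legSeq p k : ℤ) : ℂ)) q‖ ^ 2) = ((p : ℝ) - 1) ^ (p - 1) ∧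
    (∏ q ∈ Finset.univ \ {(0 : ZMod p)},
        ‖dft (fun k => ((legSeq p k : ℤ) : ℂ)) q‖ ^ 2 / p) ^ ((1 : ℝ) / (p - 1))
      = 1 - 1 / (p : ℝ) := by
  refine ⟨prod_norm_sq_dft_legSeq p h1, ?_⟩
  have hp := (Fact.out : p.Prime)
  have hp1 : (1 : ℝ) ≤ p := by exact_mod_cast hp.one_le
  have hcast : (1 : ℝ) / (p - 1) = ((p - 1 : ℕ) : ℝ)⁻¹ := by
    rw [Nat.cast_sub hp.one_le, Nat.cast_one, one_div]
  have hne : p - 1 ≠ 0 := by have := hp.two_le; omega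
  rw [Finset.prod_div_distrib, prod_norm_sq_dft_legSeq p h1, Finset.prod_const, card_univ_sdiff_zero, ← div_pow,
    hcast, Real.pow_rpow_inv_natCast (div_nonneg (by linarith) (by linarith)) hne, sub_div,
    div_self (by linarith)]
end
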